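/- Let D ⊆ ℝ^d be a closed convex set and r > 0 with B_r(0) ⊆ D, let 𝔪 be the Minkowski function of D, and let ρ : ℝ^d → ℝ be a smooth nonnegative function supported in the closed unit ball with ∫ ρ = 1. For δ > 0 set 𝔪_δ = 𝔪 * ρ_δ where ρ_δ(x) = δ^{-d} ρ(x/δ). If δ < r/4 and δ ∫_{ℝ^d} ‖u‖ ρ(u) du < r/2, then 𝔪_δ is infinitely differentiable, and for every x ∈ ℝ^d with 𝔪_δ(x) = 1 one has ⟨∇𝔪_δ(x), x⟩ > 0; in particular ∇𝔪_δ does not vanish on the level set {𝔪_δ = 1}. (Nondegeneracy of the mollified gauge, proved inside Proposition A.4.) -/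

import Mathlib

open Set MeasureTheory Pointwise
open scoped RealInnerProductSpace

/-- The Minkowski (gauge) function `𝔪(x) = inf {λ ≥ 0 : x ∈ λ D}` of a set `D`. -/
noncomputable def minkowskiFn {d : ℕ} (D : Set (EuclideanSpace ℝ (Fin d)))
    (x : EuclideanSpace ℝ (Fin d)) : ℝ :=
  sInf {l : ℝ | 0 ≤ l ∧ x ∈ l • D}

/-- The mollified gauge `𝔪_δ = 𝔪 * ρ_δ`, where `ρ_δ(x) = δ^{-d} ρ(x/δ)`. -/
noncomputable def mollifiedGauge {d : ℕ} (D : Set (EuclideanSpace ℝ (Fin d)))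
    (ρ : EuclideanSpace ℝ (Fin d) → ℝ) (δ : ℝ) (x : EuclideanSpace ℝ (Fin d)) : ℝ :=
  ∫ y, minkowskiFn D (x - y) * (δ ^ (-(d : ℤ)) * ρ (δ⁻¹ • y))

theorem minkowskiFn_eq_gauge {d : ℕ} (D : Set (EuclideanSpace ℝ (Fin d)))
    (h0 : (0 : EuclideanSpace ℝ (Fin d)) ∈ D) : minkowskiFn D = gauge D := by
  funext x
  by_cases hx : x = 0
  · subst hx
    rw [gauge_zero]
    apply le_antisymm
    · exact csInf_le ⟨0, fun l hl => hl.1⟩ ⟨le_rfl, ⟨0, h0, by simp⟩⟩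
    · exact Real.sInf_nonneg fun l hl => hl.1
  · rw [gauge_def, minkowskiFn]
    congr 1
    ext l
    constructor
    · rintro ⟨h1, h2⟩
      refine ⟨lt_of_le_of_ne h1 ?_, h2⟩
      rintro rfl
      obtain ⟨z, -, hz⟩ := h2
      simp at hz
      exact hx hz.symm
    · rintro ⟨h1, h2⟩
      exact ⟨le_of_lt h1, h2⟩

theorem mollified_gauge_smooth_nondegenerate {d : ℕ}
    (D : Set (EuclideanSpace ℝ (Fin d))) (hDcl : IsClosed D) (hDconv : Convex ℝ D)
    (r : ℝ) (hr : 0 < r) (hball : Metric.ball (0 : EuclideanSpace ℝ (Fin d)) r ⊆ D)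
    (ρ : EuclideanSpace ℝ (Fin d) → ℝ) (hρsm : ContDiff ℝ (⊤ : ℕ∞) ρ) (hρ0 : ∀ x, 0 ≤ ρ x)
    (hρs : tsupport ρ ⊆ Metric.closedBall 0 1) (hρ1 : (∫ y, ρ y) = 1)
    (δ : ℝ) (hδ0 : 0 < δ) (hδ1 : δ < r / 4) (hδ2 : δ * (∫ u, ‖u‖ * ρ u) < r / 2) :
    ContDiff ℝ (⊤ : ℕ∞) (mollifiedGauge D ρ δ) ∧
    ∀ x, mollifiedGauge D ρ δ x = 1 → 0 < ⟪gradient (mollifiedGauge D ρ δ) x, x⟫ := by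
  have hD0 : D ∈ nhds (0 : EuclideanSpace ℝ (Fin d)) :=
    Filter.mem_of_superset (Metric.ball_mem_nhds _ hr) hball
  have h0 : (0 : EuclideanSpace ℝ (Fin d)) ∈ D := mem_of_mem_nhds hD0
  have habs : Absorbent ℝ D := absorbent_nhds_zero hD0
  have hmc : Continuous (gauge D) := continuous_gauge hDconv hD0
  set ψ : EuclideanSpace ℝ (Fin d) → ℝ := fun y => δ ^ (-(d : ℤ)) * ρ (δ⁻¹ • y) with hψ
  have hf : ∀ x, mollifiedGauge D ρ δ x = ∫ y, gauge D (x - y) * ψ y := by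
    intro x
    rw [mollifiedGauge, minkowskiFn_eq_gauge D h0]
  have hψsm : ContDiff ℝ (⊤ : ℕ∞) ψ :=
    contDiff_const.mul (hρsm.comp (contDiff_const_smul _))
  have hψ0 : ∀ y, 0 ≤ ψ y := fun y => mul_nonneg (by positivity) (hρ0 _)
  have hψs : ∀ y, ψ y ≠ 0 → ‖y‖ ≤ δ := by
    intro y hy
    have h1 : ρ (δ⁻¹ • y) ≠ 0 := fun h => hy (by simp [hψ, h])
    have h2 := hρs (subset_tsupport _ h1)
    rw [mem_closedBall_zero_iff, norm_smul, norm_inv, Real.norm_of_nonneg hδ0.le,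
      inv_mul_le_iff₀ hδ0] at h2
    linarith
  have hψc : HasCompactSupport ψ := by
    refine HasCompactSupport.of_support_subset_isCompact
      (isCompact_closedBall (0 : EuclideanSpace ℝ (Fin d)) δ) ?_
    intro y hy
    rw [mem_closedBall_zero_iff]
    exact hψs y hy
  have hψ1 : ∫ y, ψ y = 1 := by
    simp only [hψ]
    rw [integral_const_mul, Measure.integral_comp_inv_smul_of_nonneg _ _ hδ0.le, hρ1]
    simp [hδ0.ne']
  have hψi : Integrable ψ := hψsm.continuous.integrable_of_hasCompactSupport hψc
  have hmint : ∀ x, Integrable (fun y => gauge D (x - y) * ψ y) := by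
    intro x
    refine Continuous.integrable_of_hasCompactSupport ?_ hψc.mul_left
    exact (hmc.comp (continuous_const.sub continuous_id)).mul hψsm.continuous
  have hsm : ContDiff ℝ (⊤ : ℕ∞) (mollifiedGauge D ρ δ) := by
    have := hψc.contDiff_convolution_left (μ := volume) (ContinuousLinearMap.mul ℝ ℝ) hψsm
      hmc.locallyIntegrable
    convert this using 1
    funext x
    rw [hf, convolution]
    simp [mul_comm]
  refine ⟨hsm, fun x hx => ?_⟩
  have hf0 : mollifiedGauge D ρ δ 0 ≤ δ / r := by
    rw [hf]
    calc ∫ y, gauge D (0 - y) * ψ y ≤ ∫ y, (δ / r) * ψ y := by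
          refine integral_mono (hmint 0) (hψi.const_mul _) fun y => ?_
          by_cases hy : ψ y = 0
          · simp [hy]
          · refine mul_le_mul_of_nonneg_right ?_ (hψ0 y)
            have h1 := mul_gauge_le_norm (x := 0 - y) hball
            rw [zero_sub, norm_neg] at h1
            rw [zero_sub, le_div_iff₀ hr]
            linarith [hψs y hy]
      _ = δ / r := by rw [integral_const_mul, hψ1, mul_one]
  have hlt : δ / r < 1 := by
    rw [div_lt_one hr]; linarith
  have hconv : ConvexOn ℝ univ (mollifiedGauge D ρ δ) := by
    refine ⟨convex_univ, fun u _ v _ a b ha hb hab => ?_⟩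
    simp only [smul_eq_mul]
    rw [hf, hf, hf, ← integral_const_mul, ← integral_const_mul,
      ← integral_add ((hmint u).const_mul _) ((hmint v).const_mul _)]
    refine integral_mono (hmint _) (((hmint u).const_mul _).add ((hmint v).const_mul _)) fun y => ?_
    have h1 : a • u + b • v - y = a • (u - y) + b • (v - y) := by
      have : y = a • y + b • y := by rw [← add_smul, hab, one_smul]
      conv_lhs => rw [this]
      module
    have h2 : gauge D (a • u + b • v - y) ≤ a * gauge D (u - y) + b * gauge D (v - y) := by
      rw [h1]
      refine (gauge_add_le hDconv habs _ _).trans_eq ?_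
      rw [gauge_smul_of_nonneg ha, gauge_smul_of_nonneg hb, smul_eq_mul, smul_eq_mul]
    have h3 := mul_le_mul_of_nonneg_right h2 (hψ0 y)
    show gauge D (a • u + b • v - y) * ψ y ≤
      a * (gauge D (u - y) * ψ y) + b * (gauge D (v - y) * ψ y)
    linarith
  have hg := hconv.comp_linearMap (LinearMap.toSpanSingleton ℝ _ x)
  have hdiff : DifferentiableAt ℝ (mollifiedGauge D ρ δ) x := hsm.differentiable (by simp) x
  have hder : HasDerivAt (mollifiedGauge D ρ δ ∘ LinearMap.toSpanSingleton ℝ _ x)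
      (fderiv ℝ (mollifiedGauge D ρ δ) x x) 1 := by
    have h1 : HasDerivAt (fun t : ℝ => t • x) x 1 := by
      simpa using (hasDerivAt_id (1 : ℝ)).smul_const x
    have h2 : HasFDerivAt (mollifiedGauge D ρ δ) (fderiv ℝ (mollifiedGauge D ρ δ) x)
        ((1 : ℝ) • x) := by
      rw [one_smul]; exact hdiff.hasFDerivAt
    exact h2.comp_hasDerivAt (1 : ℝ) h1
  have hsl := hg.slope_le_of_hasDerivAt (x := 0) (y := 1) (by simp) (by simp) one_pos hder
  rw [slope_def_field] at hsl
  simp [hx] at hsl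
  rw [gradient, InnerProductSpace.toDual_symm_apply]
  linarith
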